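/- arXiv:1605.08989 — 3 statements merged into one kernel-verified Lean document; each statement's English description precedes it below -/
import Mathlib

section
/- Let λ > 0 and let (X, r_X, μ_X), (Y, r_Y, μ_Y) be mm spaces with (X, r_X, μ_X) ≼ (Y, r_Y, μ_Y). Then the generalized Eurandom distance satisfies dgEur^λ((X,r_X,μ_X),(Y,r_Y,μ_Y)) = ∫ (1 − e^{−λ r}) ν^{2,(Y,r_Y,μ_Y)}(dr) − ∫ (1 − e^{−λ r}) ν^{2,(X,r_X,μ_X)}(dr). -/
open MeasureTheory Metric Filter Topology

namespace MMOrder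

/-- The support of a Borel measure on a metric space: the set of points all of whose
open balls have positive mass. -/
def msupp {X : Type*} [MeasurableSpace X] [MetricSpace X] (μ : Measure X) : Set X :=
  {x : X | ∀ ε : ℝ, 0 < ε → 0 < μ (Metric.ball x ε)}

/-- `τ` is a measure-preserving sub-isometry from `(Y, r_Y, μY)` to `(X, r_X, μX)`:
it maps `supp μY` into `supp μX`, pushes `μY` forward to `μX`, and is `1`-Lipschitz
on the support of `μY`. -/
def IsMPSubIsom {X Y : Type*} [MeasurableSpace X] [MetricSpace X]
    [MeasurableSpace Y] [MetricSpace Y] (μX : Measure X) (μY : Measure Y) (τ : Y → X) : Prop :=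
  Measurable τ ∧ Set.MapsTo τ (msupp μY) (msupp μX) ∧ μY.map τ = μX ∧
    ∀ y₁ ∈ msupp μY, ∀ y₂ ∈ msupp μY, dist (τ y₁) (τ y₂) ≤ dist y₁ y₂

/-- `(X, r_X, μX) ≼_metric (Y, r_Y, μY)`: there is a measure-preserving sub-isometry
from `(Y, r_Y, μY)` to `(X, r_X, μX)`. -/
def LeMetric {X Y : Type*} [MeasurableSpace X] [MetricSpace X]
    [MeasurableSpace Y] [MetricSpace Y] (μX : Measure X) (μY : Measure Y) : Prop :=
  ∃ τ : Y → X, IsMPSubIsom μX μY τ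

/-- `(X, r_X, μX) ≼ (Y, r_Y, μY)`: there is a Borel measure `μY' ≤ μY` on `Y` and a
measure-preserving sub-isometry from `(Y, r_Y, μY')` to `(X, r_X, μX)`. -/
def LeGen {X Y : Type*} [MeasurableSpace X] [MetricSpace X]
    [MeasurableSpace Y] [MetricSpace Y] (μX : Measure X) (μY : Measure Y) : Prop :=
  ∃ μY' : Measure Y, μY' ≤ μY ∧ LeMetric μX μY'

/-- `(X, r_X, μX) ≼_measure (Y, r_Y, μY)`: there is an isometry `τ` on `supp μY`
with `μX ≤ μY ∘ τ⁻¹`. -/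
def LeMeasure {X Y : Type*} [MeasurableSpace X] [MetricSpace X]
    [MeasurableSpace Y] [MetricSpace Y] (μX : Measure X) (μY : Measure Y) : Prop :=
  ∃ τ : Y → X, Measurable τ ∧
    (∀ y₁ ∈ msupp μY, ∀ y₂ ∈ msupp μY, dist (τ y₁) (τ y₂) = dist y₁ y₂) ∧
    μX ≤ μY.map τ

/-- Two mm spaces are equivalent: there is a measurable map `φ : X → Y` pushing `μX`
forward to `μY` which restricts to an isometry on `supp μX` (onto its image). -/
def MMEquiv {X Y : Type*} [MeasurableSpace X] [MetricSpace X]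
    [MeasurableSpace Y] [MetricSpace Y] (μX : Measure X) (μY : Measure Y) : Prop :=
  ∃ φ : X → Y, Measurable φ ∧ μX.map φ = μY ∧
    ∀ x₁ ∈ msupp μX, ∀ x₂ ∈ msupp μX, dist (φ x₁) (φ x₂) = dist x₁ x₂

/-- Index set for the entries of a distance matrix of order `m`:
pairs `(i, j)` with `i < j`; it has `m(m-1)/2` elements, so `DIdx m → ℝ` is
`ℝ^{m(m-1)/2}` with its coordinatewise partial order. -/
def DIdx (m : ℕ) : Type := {p : Fin m × Fin m // p.1 < p.2}

instance (m : ℕ) : MeasurableSpace (DIdx m → ℝ) := by unfold DIdx; infer_instance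
instance (m : ℕ) : PartialOrder (DIdx m → ℝ) := by unfold DIdx; infer_instance

/-- The distance matrix map of order `m`. -/
def distMatMap {X : Type*} [MetricSpace X] (m : ℕ) (x : Fin m → X) : DIdx m → ℝ :=
  fun p => dist (x p.val.1) (x p.val.2)

/-- The distance matrix measure of order `m`: the pushforward of `μ^{⊗ m}` under the
distance matrix map. -/
noncomputable def nuM {X : Type*} [MeasurableSpace X] [MetricSpace X]
    (μ : Measure X) (m : ℕ) : Measure (DIdx m → ℝ) :=
  (Measure.pi fun _ : Fin m => μ).map (distMatMap m)

/-- The distance matrix measure of order `2`, viewed as a measure on `ℝ`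
(the law of the distance of two independently sampled points). -/
noncomputable def nu2 {X : Type*} [MeasurableSpace X] [MetricSpace X]
    (μ : Measure X) : Measure ℝ :=
  (μ.prod μ).map fun p : X × X => dist p.1 p.2

/-- `∫ (1 - e^{-λ r}) ν^{2,(X,r,μ)}(dr)`. -/
noncomputable def nu2Int {X : Type*} [MeasurableSpace X] [MetricSpace X]
    (l : ℝ) (μ : Measure X) : ℝ :=
  ∫ r, (1 - Real.exp (-l * r)) ∂(nu2 μ)

/-- A metric measure space: a complete separable metric space together with a finite
Borel measure. -/
structure MM : Type 1 where
  carrier : Type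
  ms : MeasurableSpace carrier
  met : MetricSpace carrier
  sep : SecondCountableTopology carrier
  cmp : CompleteSpace carrier
  bor : BorelSpace carrier
  μ : Measure carrier
  fin : IsFiniteMeasure μ

attribute [instance] MM.ms MM.met MM.sep MM.cmp MM.bor MM.fin

/-- Gromov-weak convergence of a sequence of mm spaces: convergence of total masses and
of all integrals of bounded continuous test functions against the distance matrix
measures of every order `m ≥ 2`. -/
def GromovWeakTendsto (Z : ℕ → MM) (W : MM) : Prop :=
  Tendsto (fun n => (Z n).μ Set.univ) atTop (nhds (W.μ Set.univ)) ∧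
  ∀ m : ℕ, 2 ≤ m → ∀ φ : (DIdx m → ℝ) → ℝ, Continuous φ → (∃ C : ℝ, ∀ v, |φ v| ≤ C) →
    Tendsto (fun n => ∫ v, φ v ∂(nuM (Z n).μ m)) atTop (nhds (∫ v, φ v ∂(nuM W.μ m)))

/-- `Q` is a coupling of `μX` and `μY`. -/
def IsCoupling {X Y : Type*} [MeasurableSpace X] [MeasurableSpace Y]
    (μX : Measure X) (μY : Measure Y) (Q : Measure (X × Y)) : Prop :=
  Q.map Prod.fst = μX ∧ Q.map Prod.snd = μY

/-- The Eurandom cost `∬ |e^{-λ r_Y(y,y')} - e^{-λ r_X(x,x')}| Q(d(x,y)) Q(d(x',y'))`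
of a coupling `Q`. -/
noncomputable def eurCost {X Y : Type*} [MeasurableSpace X] [MetricSpace X]
    [MeasurableSpace Y] [MetricSpace Y] (l : ℝ) (Q : Measure (X × Y)) : ℝ :=
  ∫ p, |Real.exp (-l * dist p.1.2 p.2.2) - Real.exp (-l * dist p.1.1 p.2.1)| ∂(Q.prod Q)

/-- The Eurandom distance `dEur^λ`: the infimum of the Eurandom cost over all couplings. -/
noncomputable def dEur {X Y : Type*} [MeasurableSpace X] [MetricSpace X]
    [MeasurableSpace Y] [MetricSpace Y] (l : ℝ) (μX : Measure X) (μY : Measure Y) : ℝ :=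
  sInf {c : ℝ | ∃ Q : Measure (X × Y), IsCoupling μX μY Q ∧ c = eurCost l Q}

/-- The generalized Eurandom distance `dgEur^λ`. -/
noncomputable def dgEur {X Y : Type*} [MeasurableSpace X] [MetricSpace X]
    [MeasurableSpace Y] [MetricSpace Y] (l : ℝ) (μX : Measure X) (μY : Measure Y) : ℝ :=
  sInf {c : ℝ | ∃ (μX' : Measure X) (μY' : Measure Y), μX' ≤ μX ∧ μY' ≤ μY ∧
    μX' Set.univ = μY' Set.univ ∧
    c = ((nu2Int l μX - nu2Int l μX') + (nu2Int l μY - nu2Int l μY')) + dEur l μX' μY'}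

/-- The metric `c · r` obtained by scaling a metric by a positive constant. -/
noncomputable def scaleMetric {X : Type*} (c : ℝ) (hc : 0 < c) (m : MetricSpace X) :
    MetricSpace X where
  dist x y := c * m.dist x y
  dist_self x := by simp [m.dist_self]
  dist_comm x y := by simp [m.dist_comm x y]
  dist_triangle x y z := by
    show c * m.dist x z ≤ c * m.dist x y + c * m.dist y z
    have h := mul_le_mul_of_nonneg_left (m.dist_triangle x y z) hc.le
    linarith
  eq_of_dist_eq_zero := by
    intro x y h
    have h' : c * m.dist x y = 0 := h
    exact m.eq_of_dist_eq_zero (by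
      rcases mul_eq_zero.1 h' with h'' | h''
      · exact absurd h'' hc.ne'
      · exact h'')

/-- The `ℓ¹`-sum metric `r_X ⊕ r_Z` on a product space. -/
noncomputable def sumMetric {X Z : Type*} (mX : MetricSpace X) (mZ : MetricSpace Z) :
    MetricSpace (X × Z) where
  dist p q := mX.dist p.1 q.1 + mZ.dist p.2 q.2
  dist_self p := by simp [mX.dist_self, mZ.dist_self]
  dist_comm p q := by simp [mX.dist_comm p.1 q.1, mZ.dist_comm p.2 q.2]
  dist_triangle p q s := by
    show mX.dist p.1 s.1 + mZ.dist p.2 s.2 ≤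
      (mX.dist p.1 q.1 + mZ.dist p.2 q.2) + (mX.dist q.1 s.1 + mZ.dist q.2 s.2)
    have h1 := mX.dist_triangle p.1 q.1 s.1
    have h2 := mZ.dist_triangle p.2 q.2 s.2
    linarith
  eq_of_dist_eq_zero := by
    intro p q h
    have h' : mX.dist p.1 q.1 + mZ.dist p.2 q.2 = 0 := h
    have n1 := @dist_nonneg _ mX.toPseudoMetricSpace p.1 q.1
    have n2 := @dist_nonneg _ mZ.toPseudoMetricSpace p.2 q.2
    exact Prod.ext (mX.eq_of_dist_eq_zero (by linarith)) (mZ.eq_of_dist_eq_zero (by linarith))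

/-- The modulus of mass distribution `v_δ`. -/
noncomputable def vDelta {X : Type*} [MeasurableSpace X] [MetricSpace X]
    (μ : Measure X) (δ : ℝ) : ℝ :=
  sInf {ε : ℝ | 0 < ε ∧ μ {x : X | μ (Metric.ball x ε) ≤ ENNReal.ofReal δ} < ENNReal.ofReal ε}

/-- `P` is the countable product `μ^{⊗ ℕ}` of the probability measure `μ`, characterized
by its values on measurable cylinder sets. -/
def IsInfiniteProduct {X : Type*} [MeasurableSpace X] (μ : Measure X)
    (P : Measure (ℕ → X)) : Prop :=
  IsProbabilityMeasure P ∧ ∀ (s : Finset ℕ) (A : ℕ → Set X), (∀ i, MeasurableSet (A i)) →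
    P {f : ℕ → X | ∀ i ∈ s, f i ∈ A i} = ∏ i ∈ s, μ (A i)

/-- Index set for the entries of the infinite distance matrix: pairs `(i, j)` of
naturals with `i < j`. -/
def NIdx : Type := {p : ℕ × ℕ // p.1 < p.2}

instance : MeasurableSpace (NIdx → ℝ) := by unfold NIdx; infer_instance
instance : PartialOrder (NIdx → ℝ) := by unfold NIdx; infer_instance

/-- The infinite distance matrix map. -/
def distMatMapInf {X : Type*} [MetricSpace X] (x : ℕ → X) : NIdx → ℝ :=
  fun p => dist (x p.val.1) (x p.val.2)

/-- The simple graph on `Fin n` determined by a family of edge indicators indexed by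
the pairs `i < j`. -/
def graphOf {n : ℕ} (b : DIdx n → Bool) : SimpleGraph (Fin n) :=
  SimpleGraph.fromRel fun i j => ∃ e : DIdx n, (e.val = (i, j) ∨ e.val = (j, i)) ∧ b e = true

/-- Graph distance with the convention that points in different connected components
are at distance `n`. -/
noncomputable def graphDist {n : ℕ} (g : SimpleGraph (Fin n)) (i j : Fin n) : ℝ :=
  @ite ℝ (g.Reachable i j) (Classical.dec _) (g.dist i j : ℝ) (n : ℝ)

lemma aux_integrable {X Z : Type*} [MeasurableSpace X] [MetricSpace X]
    [SecondCountableTopology X] [BorelSpace X] [MeasurableSpace Z] (l : ℝ) (hl : 0 < l)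
    (Q : Measure (Z × Z)) [IsFiniteMeasure Q] (f : Z → X) (hf : Measurable f) :
    Integrable (fun p : Z × Z => 1 - Real.exp (-l * dist (f p.1) (f p.2))) Q := by
  refine Integrable.of_bound (C := 1) ?_ ?_
  · apply Measurable.aestronglyMeasurable
    have : Measurable fun p : Z × Z => dist (f p.1) (f p.2) :=
      (hf.comp measurable_fst).dist (hf.comp measurable_snd)
    fun_prop
  · refine Filter.Eventually.of_forall fun p => ?_
    have h1 : Real.exp (-l * dist (f p.1) (f p.2)) ≤ 1 := by
      apply Real.exp_le_one_iff.2
      have := mul_nonneg hl.le (dist_nonneg (x := f p.1) (y := f p.2))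
      linarith
    have h2 := Real.exp_pos (-l * dist (f p.1) (f p.2))
    rw [Real.norm_eq_abs, abs_le]
    constructor <;> linarith

lemma aux_nu2 {X Z : Type*} [MeasurableSpace X] [MetricSpace X]
    [SecondCountableTopology X] [BorelSpace X] [MeasurableSpace Z] (l : ℝ)
    (Q : Measure Z) [IsFiniteMeasure Q] (f : Z → X) (hf : Measurable f) :
    nu2Int l (Q.map f) = ∫ p, (1 - Real.exp (-l * dist (f p.1) (f p.2))) ∂(Q.prod Q) := by
  have hd : Measurable fun p : X × X => dist p.1 p.2 := measurable_fst.dist measurable_snd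
  unfold nu2Int nu2
  rw [integral_map hd.aemeasurable (Measurable.aestronglyMeasurable (by fun_prop)),
    Measure.map_prod_map _ _ hf hf,
    integral_map (hf.prodMap hf).aemeasurable (Measurable.aestronglyMeasurable (by fun_prop))]
  rfl

lemma aux_mono {X : Type*} [MeasurableSpace X] [MetricSpace X]
    [SecondCountableTopology X] [BorelSpace X] (l : ℝ) (hl : 0 < l)
    (μ ν : Measure X) [IsFiniteMeasure μ] [IsFiniteMeasure ν] (h : μ ≤ ν) :
    nu2Int l μ ≤ nu2Int l ν := by
  have h1 := aux_nu2 l μ id measurable_id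
  have h2 := aux_nu2 l ν id measurable_id
  rw [Measure.map_id] at h1 h2
  rw [h1, h2]
  refine integral_mono_measure (Measure.prod_mono h h) ?_
    (aux_integrable l hl _ id measurable_id)
  refine Filter.Eventually.of_forall fun p => ?_
  have h1 : Real.exp (-l * dist p.1 p.2) ≤ 1 := by
    apply Real.exp_le_one_iff.2
    have := mul_nonneg hl.le (dist_nonneg (x := p.1) (y := p.2))
    linarith
  simpa using h1

lemma aux_supp {X : Type*} [MeasurableSpace X] [MetricSpace X]
    [SecondCountableTopology X] (μ : Measure X) : ∀ᵐ x ∂μ, x ∈ msupp μ := by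
  filter_upwards [Measure.support_mem_ae (μ := μ)] with x hx ε hε
  exact (Measure.mem_support_iff_forall x).1 hx _ (Metric.ball_mem_nhds x hε)

lemma aux_lower {X Y : Type*} [MeasurableSpace X] [MetricSpace X]
    [SecondCountableTopology X] [BorelSpace X] [MeasurableSpace Y] [MetricSpace Y]
    [SecondCountableTopology Y] [BorelSpace Y] (l : ℝ) (hl : 0 < l)
    (Q : Measure (X × Y)) [IsFiniteMeasure Q] :
    nu2Int l (Q.map Prod.snd) - nu2Int l (Q.map Prod.fst) ≤ eurCost l Q := by
  have i1 := aux_integrable l hl (Q.prod Q) Prod.fst measurable_fst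
  have i2 := aux_integrable l hl (Q.prod Q) Prod.snd measurable_snd
  rw [aux_nu2 l Q _ measurable_fst, aux_nu2 l Q _ measurable_snd, ← integral_sub i2 i1]
  unfold eurCost
  refine integral_mono (i2.sub i1) ?_ fun p => ?_
  · refine (i2.sub i1).abs.congr (Filter.Eventually.of_forall fun p => ?_)
    simp only [Pi.sub_apply]
    rw [sub_sub_sub_cancel_left, abs_sub_comm]
  · simp only []
    rw [sub_sub_sub_cancel_left, abs_sub_comm]
    exact le_abs_self _

lemma aux_coupling {X Y : Type*} [MeasurableSpace X] [MeasurableSpace Y]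
    (μ : Measure X) (ν : Measure Y) [IsFiniteMeasure μ] [IsFiniteMeasure ν]
    (h : μ Set.univ = ν Set.univ) : ∃ Q, IsCoupling μ ν Q := by
  by_cases h0 : μ Set.univ = 0
  · refine ⟨0, ?_, ?_⟩
    · rw [Measure.map_zero, Measure.measure_univ_eq_zero.1 h0]
    · rw [Measure.map_zero, Measure.measure_univ_eq_zero.1 (h.symm.trans h0)]
  · refine ⟨(μ Set.univ)⁻¹ • μ.prod ν, ?_, ?_⟩
    · rw [Measure.map_smul, Measure.map_fst_prod, smul_smul, ← h,
        ENNReal.inv_mul_cancel h0 (measure_ne_top _ _), one_smul]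
    · rw [Measure.map_smul, Measure.map_snd_prod, smul_smul,
        ENNReal.inv_mul_cancel h0 (measure_ne_top _ _), one_smul]

lemma aux_fin {X Y : Type*} [MeasurableSpace X] [MeasurableSpace Y]
    (μ : Measure X) [IsFiniteMeasure μ] (Q : Measure (X × Y)) (h : Q.map Prod.fst = μ) :
    IsFiniteMeasure Q := by
  constructor
  have : Q Set.univ = μ Set.univ := by
    rw [← h, Measure.map_apply measurable_fst MeasurableSet.univ, Set.preimage_univ]
  rw [this]
  exact measure_lt_top _ _

lemma aux_dEur {X Y : Type*} [MeasurableSpace X] [MetricSpace X]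
    [SecondCountableTopology X] [BorelSpace X] [MeasurableSpace Y] [MetricSpace Y]
    [SecondCountableTopology Y] [BorelSpace Y] (l : ℝ) (hl : 0 < l)
    (μ : Measure X) (ν : Measure Y) [IsFiniteMeasure μ] [IsFiniteMeasure ν]
    (h : μ Set.univ = ν Set.univ) : nu2Int l ν - nu2Int l μ ≤ dEur l μ ν := by
  obtain ⟨Q, hQ⟩ := aux_coupling μ ν h
  refine le_csInf ⟨_, Q, hQ, rfl⟩ ?_
  rintro c ⟨Q, ⟨h1, h2⟩, rfl⟩
  have := aux_fin μ Q h1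
  have := aux_lower l hl Q
  rwa [h1, h2] at this

lemma aux_upper {X Y : Type*} [MeasurableSpace X] [MetricSpace X]
    [SecondCountableTopology X] [BorelSpace X] [MeasurableSpace Y] [MetricSpace Y]
    [SecondCountableTopology Y] [BorelSpace Y] (l : ℝ) (hl : 0 < l)
    (μ : Measure X) (ν : Measure Y) [IsFiniteMeasure ν] (τ : Y → X)
    (h : IsMPSubIsom μ ν τ) : dEur l μ ν ≤ nu2Int l ν - nu2Int l μ := by
  obtain ⟨hτ, -, rfl, hd⟩ := h
  have hg : Measurable fun y => (τ y, y) := hτ.prodMk measurable_id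
  refine csInf_le ⟨0, ?_⟩ ⟨ν.map fun y => (τ y, y), ⟨?_, ?_⟩, ?_⟩
  · rintro c ⟨Q, -, rfl⟩
    exact integral_nonneg fun p => abs_nonneg _
  · rw [Measure.map_map measurable_fst hg]; rfl
  · rw [Measure.map_map measurable_snd hg]; exact Measure.map_id
  · have h1 := aux_nu2 l ν id measurable_id
    rw [Measure.map_id] at h1
    rw [h1, aux_nu2 l ν τ hτ, ← integral_sub (aux_integrable l hl _ id measurable_id)
      (aux_integrable l hl _ τ hτ)]
    unfold eurCost
    have m1 : Measurable fun p : (X × Y) × (X × Y) => dist p.1.2 p.2.2 :=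
      (measurable_snd.comp measurable_fst).dist (measurable_snd.comp measurable_snd)
    have m2 : Measurable fun p : (X × Y) × (X × Y) => dist p.1.1 p.2.1 :=
      (measurable_fst.comp measurable_fst).dist (measurable_fst.comp measurable_snd)
    rw [Measure.map_prod_map _ _ hg hg, integral_map (hg.prodMap hg).aemeasurable
      (Measurable.aestronglyMeasurable (by
        have m3 : Measurable fun p : (X × Y) × (X × Y) =>
          Real.exp (-l * dist p.1.2 p.2.2) - Real.exp (-l * dist p.1.1 p.2.1) := by fun_prop
        exact continuous_abs.measurable.comp m3))]
    apply integral_congr_ae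
    have s1 : ∀ᵐ p ∂(ν.prod ν), p.1 ∈ msupp ν :=
      Measure.quasiMeasurePreserving_fst.ae (aux_supp ν)
    have s2 : ∀ᵐ p ∂(ν.prod ν), p.2 ∈ msupp ν :=
      Measure.quasiMeasurePreserving_snd.ae (aux_supp ν)
    filter_upwards [s1, s2] with p hp1 hp2
    have hle : Real.exp (-l * dist p.1 p.2) ≤ Real.exp (-l * dist (τ p.1) (τ p.2)) := by
      apply Real.exp_le_exp.2
      have := mul_le_mul_of_nonneg_left (hd _ hp1 _ hp2) hl.le
      linarith
    simp only [Prod.map, id]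
    rw [abs_of_nonpos (by linarith)]
    ring

/-- if `(X, r_X, μ_X) ≼ (Y, r_Y, μ_Y)` (finite mm spaces), then the
generalized Eurandom distance `dgEur^λ` equals the difference of the integrals of
`1 - e^{-λ r}` against the distance matrix measures of order 2. -/
theorem stmt11 {X Y : Type*} [MeasurableSpace X] [MetricSpace X] [SecondCountableTopology X] [CompleteSpace X] [BorelSpace X] [MeasurableSpace Y] [MetricSpace Y] [SecondCountableTopology Y] [CompleteSpace Y] [BorelSpace Y]
    (l : ℝ) (hl : 0 < l)
    (μX : Measure X) (μY : Measure Y)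
    [IsFiniteMeasure μX] [IsFiniteMeasure μY]
    (h : LeGen μX μY) :
    dgEur l μX μY = nu2Int l μY - nu2Int l μX := by
  obtain ⟨μY', hle, τ, hτ⟩ := h
  have fin_of : ∀ ν : Measure Y, ν ≤ μY → IsFiniteMeasure ν := fun ν hν =>
    isFiniteMeasure_of_le μY hν
  have finX_of : ∀ ν : Measure X, ν ≤ μX → IsFiniteMeasure ν := fun ν hν =>
    isFiniteMeasure_of_le μX hν
  have lower : ∀ c ∈ {c : ℝ | ∃ (μX' : Measure X) (μY' : Measure Y), μX' ≤ μX ∧ μY' ≤ μY ∧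
      μX' Set.univ = μY' Set.univ ∧
      c = ((nu2Int l μX - nu2Int l μX') + (nu2Int l μY - nu2Int l μY')) + dEur l μX' μY'},
      nu2Int l μY - nu2Int l μX ≤ c := by
    rintro c ⟨ρ, σ, h1, h2, h3, rfl⟩
    have := fin_of σ h2
    have := finX_of ρ h1
    have a := aux_dEur l hl ρ σ h3
    have b := aux_mono l hl ρ μX h1
    linarith
  have := fin_of μY' hle
  have hm : μX Set.univ = μY' Set.univ := by
    rw [← hτ.2.2.1, Measure.map_apply hτ.1 MeasurableSet.univ, Set.preimage_univ]
  have up := aux_upper l hl μX μY' τ hτ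
  apply le_antisymm
  · refine (csInf_le ⟨_, lower⟩ ⟨μX, μY', le_rfl, hle, hm, rfl⟩).trans ?_
    linarith
  · exact le_csInf ⟨_, μX, μY', le_rfl, hle, hm, rfl⟩ lower

end MMOrder
end

section
/- Let (X, r_X, μ_X) and (Y, r_Y, μ_Y) be probability mm spaces with (X, r_X, μ_X) ≼_metric (Y, r_Y, μ_Y) and ν^{2,(X,r_X,μ_X)} = ν^{2,(Y,r_Y,μ_Y)}. Then (X, r_X, μ_X) and (Y, r_Y, μ_Y) are equivalent. -/
open MeasureTheory Metric Filter Topology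

namespace MMOrder

theorem msupp_eq_support {X : Type*} [MeasurableSpace X] [MetricSpace X] (μ : Measure X) :
    msupp μ = μ.support := by
  ext x
  rw [(Metric.nhds_basis_ball (x := x)).mem_measureSupport]
  simp [msupp]

theorem subisom_ae_dist_eq {X Y : Type*} [MeasurableSpace X] [MetricSpace X]
    [SecondCountableTopology X] [BorelSpace X] [MeasurableSpace Y] [MetricSpace Y]
    [SecondCountableTopology Y] [BorelSpace Y]
    (μX : Measure X) (μY : Measure Y) [IsProbabilityMeasure μX] [IsProbabilityMeasure μY]
    (τ : Y → X) (hm : Measurable τ) (hmap : μY.map τ = μX)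
    (hle : ∀ᵐ p ∂(μY.prod μY), dist (τ p.1) (τ p.2) ≤ dist p.1 p.2)
    (h2 : nu2 μX = nu2 μY) :
    ∀ᵐ p ∂(μY.prod μY), dist (τ p.1) (τ p.2) = dist p.1 p.2 := by
  have hd1 : Measurable fun p : Y × Y => dist (τ p.1) (τ p.2) :=
    (hm.comp measurable_fst).dist (hm.comp measurable_snd)
  have hd2 : Measurable fun p : Y × Y => dist p.1 p.2 := measurable_dist
  have h3 : (μY.prod μY).map (fun p : Y × Y => dist (τ p.1) (τ p.2))
      = (μY.prod μY).map (fun p : Y × Y => dist p.1 p.2) := by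
    unfold nu2 at h2
    rw [← h2, ← hmap, Measure.map_prod_map _ _ hm hm,
      Measure.map_map measurable_dist (hm.prodMap hm)]
    rfl
  have ha : Measurable Real.arctan := Real.continuous_arctan.measurable
  have hint : ∀ f : Y × Y → ℝ, Measurable f →
      Integrable (fun p => Real.arctan (f p)) (μY.prod μY) := by
    intro f hf
    refine Integrable.of_bound (ha.comp hf).aestronglyMeasurable (Real.pi / 2) ?_
    refine Eventually.of_forall fun p => ?_
    rw [Real.norm_eq_abs, abs_le]
    exact ⟨(Real.neg_pi_div_two_lt_arctan _).le, (Real.arctan_lt_pi_div_two _).le⟩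
  have h4 : ∫ p, Real.arctan (dist (τ p.1) (τ p.2)) ∂(μY.prod μY)
      = ∫ p, Real.arctan (dist p.1 p.2) ∂(μY.prod μY) := by
    rw [← integral_map (φ := fun p : Y × Y => dist (τ p.1) (τ p.2)) (f := Real.arctan)
      hd1.aemeasurable ha.aestronglyMeasurable,
      ← integral_map (φ := fun p : Y × Y => dist p.1 p.2) (f := Real.arctan)
      hd2.aemeasurable ha.aestronglyMeasurable, h3]
  have h5 : ∫ p, (Real.arctan (dist p.1 p.2) - Real.arctan (dist (τ p.1) (τ p.2)))
      ∂(μY.prod μY) = 0 := by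
    rw [integral_sub (hint _ hd2) (hint _ hd1), h4, sub_self]
  rw [integral_eq_zero_iff_of_nonneg_ae] at h5
  · filter_upwards [h5] with p hp
    exact Real.arctan_injective (sub_eq_zero.1 hp).symm
  · filter_upwards [hle] with p hp
    exact sub_nonneg.2 (Real.arctan_strictMono.monotone hp)
  · exact (hint _ hd2).sub (hint _ hd1)

/-- if `(X, r_X, μ_X) ≼_metric (Y, r_Y, μ_Y)` and the distance matrix
measures of order 2 coincide, then the two probability mm spaces are equivalent. -/
theorem stmt15 {X Y : Type*} [MeasurableSpace X] [MetricSpace X] [SecondCountableTopology X] [CompleteSpace X] [BorelSpace X] [MeasurableSpace Y] [MetricSpace Y] [SecondCountableTopology Y] [CompleteSpace Y] [BorelSpace Y]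
    (μX : Measure X) (μY : Measure Y)
    [IsProbabilityMeasure μX] [IsProbabilityMeasure μY]
    (h : LeMetric μX μY) (h2 : nu2 μX = nu2 μY) :
    MMEquiv μX μY := by
  obtain ⟨τ, hm, hmaps, hmap, hlip⟩ := h
  have hS : msupp μY ∈ ae μY := by
    rw [msupp_eq_support]; exact Measure.support_mem_ae
  have hcl : IsClosed (msupp μY) := by
    rw [msupp_eq_support]; exact Measure.isClosed_support
  have hSS : ∀ᵐ p ∂(μY.prod μY), p.1 ∈ msupp μY ∧ p.2 ∈ msupp μY :=
    (Measure.quasiMeasurePreserving_fst.ae hS).and (Measure.quasiMeasurePreserving_snd.ae hS)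
  have hae := subisom_ae_dist_eq μX μY τ hm hmap
    (hSS.mono fun p hp => hlip _ hp.1 _ hp.2) h2
  have hiso : ∀ y₁ ∈ msupp μY, ∀ y₂ ∈ msupp μY, dist (τ y₁) (τ y₂) = dist y₁ y₂ := by
    intro a ha b hb
    by_contra hne
    have hlt := lt_of_le_of_ne (hlip a ha b hb) hne
    set δ := dist a b - dist (τ a) (τ b) with hδ
    have hpos : 0 < δ := sub_pos.2 hlt
    have hz : (μY.prod μY) (ball a (δ / 4) ×ˢ ball b (δ / 4)) = 0 := by
      rw [measure_eq_zero_iff_ae_notMem]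
      filter_upwards [hSS, hae] with p hp hpe hmem
      have m1 : dist p.1 a < δ / 4 := hmem.1
      have m2 : dist p.2 b < δ / 4 := hmem.2
      have l1 := hlip _ hp.1 _ ha
      have l2 := hlip _ hp.2 _ hb
      have t1 := dist_triangle4 (τ p.1) (τ a) (τ b) (τ p.2)
      have t2 := dist_triangle4 a p.1 p.2 b
      rw [dist_comm (τ b)] at t1
      rw [dist_comm a p.1] at t2
      linarith
    rw [Measure.prod_prod, mul_eq_zero] at hz
    have q1 := ha (δ / 4) (by positivity)
    have q2 := hb (δ / 4) (by positivity)
    rcases hz with hz | hz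
    · exact q1.ne' hz
    · exact q2.ne' hz
  let f : msupp μY → X := fun y => τ y
  have hf : Isometry f := Isometry.of_dist_eq fun a b => hiso a a.2 b b.2
  haveI : CompleteSpace (msupp μY) := hcl.completeSpace_coe
  have hemb := hf.isClosedEmbedding
  have hne : Nonempty Y := nonempty_of_isProbabilityMeasure μY
  obtain ⟨φ, hφ, hφf⟩ := hemb.measurableEmbedding.exists_measurable_extend
    (measurable_subtype_coe (p := fun y => y ∈ msupp μY)) (fun _ => hne)
  have hφτ : ∀ y ∈ msupp μY, φ (τ y) = y := fun y hy => congrFun hφf ⟨y, hy⟩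
  have hsub : msupp μX ⊆ Set.range f := by
    rw [msupp_eq_support]
    refine Measure.support_subset_of_isClosed hemb.isClosed_range ?_
    rw [← hmap]
    refine (mem_ae_map_iff hm.aemeasurable hemb.isClosed_range.measurableSet).2 ?_
    filter_upwards [hS] with y hy
    exact ⟨⟨y, hy⟩, rfl⟩
  refine ⟨φ, hφ, ?_, ?_⟩
  · rw [← hmap, Measure.map_map hφ hm]
    conv_rhs => rw [← Measure.map_id (μ := μY)]
    refine Measure.map_congr ?_
    filter_upwards [hS] with y hy
    exact hφτ y hy
  · intro x₁ h₁ x₂ h₂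
    obtain ⟨a, rfl⟩ := hsub h₁
    obtain ⟨b, rfl⟩ := hsub h₂
    show dist (φ (τ a)) (φ (τ b)) = dist (τ a) (τ b)
    rw [hφτ a a.2, hφτ b b.2, hiso a a.2 b b.2]

end MMOrder
end

section
/- Let (X, r_X, μ_X) and (Y, r_Y, μ_Y) be probability mm spaces with (X, r_X, μ_X) ≼_metric (Y, r_Y, μ_Y). Then for every δ > 0 the moduli of mass distribution satisfy v_δ((X, r_X, μ_X)) ≤ v_δ((Y, r_Y, μ_Y)). -/
open MeasureTheory Metric Filter Topology

namespace MMOrder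

/-- the modulus of mass distribution is monotone with respect to
`≼_metric`. -/
theorem stmt18 {X Y : Type*} [MeasurableSpace X] [MetricSpace X] [SecondCountableTopology X] [CompleteSpace X] [BorelSpace X] [MeasurableSpace Y] [MetricSpace Y] [SecondCountableTopology Y] [CompleteSpace Y] [BorelSpace Y]
    (μX : Measure X) (μY : Measure Y)
    [IsProbabilityMeasure μX] [IsProbabilityMeasure μY]
    (h : LeMetric μX μY) :
    ∀ δ : ℝ, 0 < δ → vDelta μX δ ≤ vDelta μY δ := by
  intro δ _
  obtain ⟨τ, hm, -, hmap, hlip⟩ := h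
  have hae : ∀ᵐ y ∂μY, y ∈ msupp μY := by
    have h0 : μY.support ∈ ae μY := Measure.support_mem_ae
    filter_upwards [h0] with y hy ε hε
    exact (Measure.mem_support_iff_forall y).1 hy _ (Metric.ball_mem_nhds y hε)
  have hball : ∀ ε : ℝ, ∀ y ∈ msupp μY, μY (Metric.ball y ε) ≤ μX (Metric.ball (τ y) ε) := by
    intro ε y hy
    rw [← hmap, Measure.map_apply hm Metric.isOpen_ball.measurableSet]
    apply measure_mono_ae
    filter_upwards [hae] with z hz hzb
    exact lt_of_le_of_lt (hlip z hz y hy) hzb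
  have hmeas : ∀ ε : ℝ, MeasurableSet {x : X | μX (Metric.ball x ε) ≤ ENNReal.ofReal δ} := by
    intro ε
    have hs : MeasurableSet {p : X × X | dist p.2 p.1 < ε} :=
      (isOpen_lt (continuous_snd.dist continuous_fst) continuous_const).measurableSet
    exact measurableSet_le (measurable_measure_prodMk_left (ν := μX) hs) measurable_const
  unfold vDelta
  apply csInf_le_csInf
  · exact ⟨0, fun ε hε => hε.1.le⟩
  · refine ⟨2, by norm_num, lt_of_le_of_lt prob_le_one ?_⟩
    rw [ENNReal.one_lt_ofReal]
    norm_num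
  · rintro ε ⟨hε, hlt⟩
    refine ⟨hε, lt_of_le_of_lt ?_ hlt⟩
    have h1 : μX {x : X | μX (Metric.ball x ε) ≤ ENNReal.ofReal δ} =
        μY (τ ⁻¹' {x : X | μX (Metric.ball x ε) ≤ ENNReal.ofReal δ}) := by
      rw [← Measure.map_apply hm (hmeas ε), hmap]
    rw [h1]
    apply measure_mono_ae
    filter_upwards [hae] with y hy hyb
    exact (hball ε y hy).trans hyb

end MMOrder
end
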